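/- arXiv:1705.09123 — 3 statements merged into one kernel-verified Lean document; each statement's English description precedes it below -/
import Mathlib

section
/- Let K ⊆ ℝ^d be the attractor of a Euclidean IFS of similitudes with similarity dimension α, endowed with its natural fractal structure. If F satisfies the open set condition (OSC), then dim_H(K) = dim⁴(K) = dim³(K) = α. -/
open scoped ENNReal

namespace IFSMoran

variable {X : Type*} [MetricSpace X]

/-- The map `f_i = f_{i1} o ... o f_{in}` associated to a word `i = i1...in`
(a list of indices). -/
def wMap {k : ℕ} (f : Fin k → X → X) : List (Fin k) → X → X
  | [] => id
  | i :: w => f i ∘ wMap f w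

/-- The piece `A_i = f_i(K)` of the natural fractal structure. -/
def piece {k : ℕ} (f : Fin k → X → X) (K : Set X) (w : List (Fin k)) : Set X :=
  wMap f w '' K

/-- The natural fractal structure (levels indexed by words) is irreducible:
no level admits a proper subcovering. -/
def Irred {k : ℕ} (f : Fin k → X → X) (K : Set X) : Prop :=
  ∀ w : List (Fin k),
    ¬ piece f K w ⊆ ⋃ v ∈ {v : List (Fin k) | v.length = w.length ∧ v ≠ w}, piece f K v

/-- `H³ₙˢ(K) = inf_{l ≥ n} ∑_{i ∈ Σˡ} diam (A_i) ^ s`. -/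
noncomputable def H3n {k : ℕ} (f : Fin k → X → X) (K : Set X) (s : ℝ) (n : ℕ) : ℝ≥0∞ :=
  ⨅ (l : ℕ) (_ : n ≤ l),
    ∑ w : Fin l → Fin k, EMetric.diam (piece f K (List.ofFn w)) ^ s

/-- `H³ˢ(K) = lim_n H³ₙˢ(K)`; the sequence is nondecreasing in `n`, so the limit
is the supremum. -/
noncomputable def H3 {k : ℕ} (f : Fin k → X → X) (K : Set X) (s : ℝ) : ℝ≥0∞ :=
  ⨆ n, H3n f K s n

/-- Fractal dimension III: `dim³(K) = inf {s ≥ 0 : H³ˢ(K) = 0}`. -/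
noncomputable def dim3 {k : ℕ} (f : Fin k → X → X) (K : Set X) : ℝ :=
  sInf {s : ℝ | 0 ≤ s ∧ H3 f K s = 0}

/-- `H⁴ₙˢ(K)`: infimum of `∑ diam (A_i) ^ s` over finite coverings of `K` by
pieces indexed by words of length `≥ n`. -/
noncomputable def H4n {k : ℕ} (f : Fin k → X → X) (K : Set X) (s : ℝ) (n : ℕ) : ℝ≥0∞ :=
  ⨅ (𝒜 : Finset (List (Fin k))) (_ : ∀ w ∈ 𝒜, n ≤ w.length)
      (_ : K ⊆ ⋃ w ∈ 𝒜, piece f K w),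
    ∑ w ∈ 𝒜, EMetric.diam (piece f K w) ^ s

/-- `H⁴ˢ(K) = lim_n H⁴ₙˢ(K)`; the sequence is nondecreasing in `n`, so the limit
is the supremum. -/
noncomputable def H4 {k : ℕ} (f : Fin k → X → X) (K : Set X) (s : ℝ) : ℝ≥0∞ :=
  ⨆ n, H4n f K s n

/-- Fractal dimension IV: `dim⁴(K) = inf {s ≥ 0 : H⁴ˢ(K) = 0}`. -/
noncomputable def dim4 {k : ℕ} (f : Fin k → X → X) (K : Set X) : ℝ :=
  sInf {s : ℝ | 0 ≤ s ∧ H4 f K s = 0}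

/-- Interior of `A` relative to `K` (as a subset of the ambient space `X`). -/
def intK (K A : Set X) : Set X := K \ closure (K \ A)

/-- The level separation property: interiors (in `K`) of two pieces indexed by
distinct words of the same length are disjoint (LSP1), and every piece has
nonempty interior in `K` (LSP2). -/
def LSP {k : ℕ} (f : Fin k → X → X) (K : Set X) : Prop :=
  (∀ v w : List (Fin k), v.length = w.length → v ≠ w →
      intK K (piece f K v) ∩ intK K (piece f K w) = ∅) ∧
  ∀ w : List (Fin k), (intK K (piece f K w)).Nonempty

/-- The natural fractal structure is a tiling: pieces indexed by distinct words
of the same length have disjoint interiors in `K`, and every piece is regularly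
closed in `K`, i.e. `cl_K (int_K (A_i)) = A_i`. -/
def IsTiling {k : ℕ} (f : Fin k → X → X) (K : Set X) : Prop :=
  (∀ v w : List (Fin k), v.length = w.length → v ≠ w →
      intK K (piece f K v) ∩ intK K (piece f K w) = ∅) ∧
  ∀ w : List (Fin k), closure (intK K (piece f K w)) ∩ K = piece f K w

open MeasureTheory Metric Filter Topology

/-- The contraction ratio of `wMap f w`: the product of the ratios of its letters. -/
def wRatio {k : ℕ} (c : Fin k → ℝ) (w : List (Fin k)) : ℝ := (w.map c).prod

@[simp]
lemma wRatio_nil {k : ℕ} (c : Fin k → ℝ) : wRatio c [] = 1 := by simp [wRatio]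

@[simp]
lemma wRatio_cons {k : ℕ} (c : Fin k → ℝ) (i : Fin k) (w : List (Fin k)) :
    wRatio c (i :: w) = c i * wRatio c w := by simp [wRatio]

lemma wRatio_nonneg {k : ℕ} {c : Fin k → ℝ} (hc : ∀ i, 0 ≤ c i) (w : List (Fin k)) :
    0 ≤ wRatio c w := by
  induction w with
  | nil => simp
  | cons i w ih => simpa using mul_nonneg (hc i) ih

lemma wRatio_le_pow {k : ℕ} {c : Fin k → ℝ} (hc : ∀ i, 0 ≤ c i) {b : ℝ} (hb : ∀ i, c i ≤ b)
    (w : List (Fin k)) : wRatio c w ≤ b ^ w.length := by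
  induction w with
  | nil => simp
  | cons i w ih =>
    rw [wRatio_cons, List.length_cons, pow_succ']
    exact mul_le_mul (hb i) ih (wRatio_nonneg hc w) ((hc i).trans (hb i))

lemma wRatio_ofFn {k l : ℕ} (c : Fin k → ℝ) (v : Fin l → Fin k) :
    wRatio c (List.ofFn v) = ∏ j, c (v j) := by
  simp [wRatio, List.map_ofFn, List.prod_ofFn]

lemma sum_wRatio_rpow {k : ℕ} {c : Fin k → ℝ} (hc : ∀ i, 0 ≤ c i) (s : ℝ) (l : ℕ) :
    ∑ v : Fin l → Fin k, wRatio c (List.ofFn v) ^ s = (∑ i, c i ^ s) ^ l := by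
  rw [Fintype.sum_pow]
  refine Finset.sum_congr rfl fun v _ => ?_
  rw [wRatio_ofFn, Real.finsetProd_rpow _ _ fun j _ => hc (v j)]

lemma dist_wMap {k : ℕ} {f : Fin k → X → X} {c : Fin k → ℝ}
    (hf : ∀ i x y, dist (f i x) (f i y) = c i * dist x y) (w : List (Fin k)) (x y : X) :
    dist (wMap f w x) (wMap f w y) = wRatio c w * dist x y := by
  induction w with
  | nil => simp [wMap]
  | cons i w ih => simp [wMap, hf, ih, mul_assoc]

lemma wMap_surjective {Y : Type*} {k : ℕ} {f : Fin k → Y → Y} (hf : ∀ i, Function.Surjective (f i))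
    (w : List (Fin k)) : Function.Surjective (wMap f w) := by
  induction w with
  | nil => exact Function.surjective_id
  | cons i w ih => exact (hf i).comp ih

lemma wMap_mapsTo {Y : Type*} {k : ℕ} {f : Fin k → Y → Y} {A : Set Y} (hf : ∀ i, f i '' A ⊆ A)
    (w : List (Fin k)) : wMap f w '' A ⊆ A := by
  induction w with
  | nil => simp [wMap]
  | cons i w ih =>
    rw [wMap, Set.image_comp]
    exact (Set.image_mono ih).trans (hf i)

lemma piece_cons {Y : Type*} {k : ℕ} (f : Fin k → Y → Y) (K : Set Y) (i : Fin k) (w : List (Fin k)) :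
    piece f K (i :: w) = f i '' piece f K w := by
  simp [piece, wMap, Set.image_comp]

lemma ediam_piece_le {k : ℕ} {f : Fin k → X → X} {c : Fin k → ℝ}
    (hf : ∀ i x y, dist (f i x) (f i y) = c i * dist x y) (K : Set X) (w : List (Fin k)) :
    ediam (piece f K w) ≤ ENNReal.ofReal (wRatio c w) * ediam K := by
  refine LipschitzWith.ediam_image_le (K := (wRatio c w).toNNReal) ?_ K
  exact LipschitzWith.of_dist_le_mul fun x y => by
    rw [dist_wMap hf]
    exact mul_le_mul_of_nonneg_right (Real.le_coe_toNNReal _) dist_nonneg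

lemma subset_iUnion_piece_ofFn {Y : Type*} {k : ℕ} {f : Fin k → Y → Y} {K : Set Y}
    (hK : K = ⋃ i, f i '' K) (l : ℕ) :
    K ⊆ ⋃ v : Fin l → Fin k, piece f K (List.ofFn v) := by
  induction l with
  | zero => exact fun x hx => Set.mem_iUnion.2 ⟨Fin.elim0, by simpa [piece, wMap] using hx⟩
  | succ l ih =>
    intro x hx
    rw [hK] at hx
    obtain ⟨i, y, hy, rfl⟩ := Set.mem_iUnion.1 hx
    obtain ⟨v, hv⟩ := Set.mem_iUnion.1 (ih hy)
    refine Set.mem_iUnion.2 ⟨Fin.cons i v, ?_⟩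
    rw [List.ofFn_succ]
    simpa [piece_cons] using ⟨y, hv, rfl⟩

/-- The sum over a level is bounded by a power of the pressure sum `∑ cᵢˢ`. -/
lemma sum_ediam_piece_rpow_le {k : ℕ} {f : Fin k → X → X} {c : Fin k → ℝ} (hc : ∀ i, 0 ≤ c i)
    (hf : ∀ i x y, dist (f i x) (f i y) = c i * dist x y) (K : Set X) {s : ℝ} (hs : 0 ≤ s)
    (l : ℕ) :
    ∑ v : Fin l → Fin k, ediam (piece f K (List.ofFn v)) ^ s ≤
      ENNReal.ofReal (∑ i, c i ^ s) ^ l * ediam K ^ s := by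
  calc ∑ v : Fin l → Fin k, ediam (piece f K (List.ofFn v)) ^ s
      ≤ ∑ v : Fin l → Fin k, ENNReal.ofReal (wRatio c (List.ofFn v) ^ s) * ediam K ^ s := by
        refine Finset.sum_le_sum fun v _ => ?_
        rw [← ENNReal.ofReal_rpow_of_nonneg (wRatio_nonneg hc _) hs,
          ← ENNReal.mul_rpow_of_nonneg _ _ hs]
        exact ENNReal.rpow_le_rpow (ediam_piece_le hf K _) hs
    _ = _ := by
        rw [← Finset.sum_mul, ← ENNReal.ofReal_sum_of_nonneg fun v _ =>
            Real.rpow_nonneg (wRatio_nonneg hc _) _, sum_wRatio_rpow hc,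
          ENNReal.ofReal_pow (Finset.sum_nonneg fun i _ => Real.rpow_nonneg (hc i) _)]

lemma H4_le_H3 {k : ℕ} {f : Fin k → X → X} {K : Set X} (hK : K = ⋃ i, f i '' K) (s : ℝ) :
    H4 f K s ≤ H3 f K s := by
  classical
  refine iSup_mono fun n => le_iInf₂ fun l hl => ?_
  refine (iInf₂_le (Finset.univ.image (List.ofFn : (Fin l → Fin k) → List (Fin k))) ?_).trans ?_
  · simpa using fun _ => hl
  · refine (iInf_le _ ?_).trans ?_
    · simpa using subset_iUnion_piece_ofFn hK l
    · rw [Finset.sum_image List.ofFn_injective.injOn]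

lemma H3_eq_zero {k : ℕ} {f : Fin k → X → X} {c : Fin k → ℝ} (hc : ∀ i, 0 ≤ c i)
    (hf : ∀ i x y, dist (f i x) (f i y) = c i * dist x y) {K : Set X} (hK : ediam K ≠ ⊤)
    {s : ℝ} (hs : 0 ≤ s) (hsum : ∑ i, c i ^ s < 1) : H3 f K s = 0 := by
  refine le_antisymm (iSup_le fun n => ?_) bot_le
  have hlim : Tendsto (fun l : ℕ => ENNReal.ofReal (∑ i, c i ^ s) ^ l * ediam K ^ s) atTop
      (𝓝 (0 * ediam K ^ s)) :=
    ENNReal.Tendsto.mul_const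
      (ENNReal.tendsto_pow_atTop_nhds_zero_of_lt_one (by simpa using hsum))
      (Or.inr (ENNReal.rpow_ne_top_of_nonneg hs hK))
  rw [zero_mul] at hlim
  refine ge_of_tendsto hlim ((eventually_ge_atTop n).mono fun l hl => ?_)
  exact (iInf₂_le l hl).trans (sum_ediam_piece_rpow_le hc hf K hs l)

section Hausdorff

variable [MeasurableSpace X] [BorelSpace X]

lemma hausdorffMeasure_lt_top_of_sum_eq_one {k : ℕ} {f : Fin k → X → X} {c : Fin k → ℝ}
    (hc : ∀ i, 0 ≤ c i) {b : ℝ} (hb0 : 0 ≤ b) (hb1 : b < 1) (hb : ∀ i, c i ≤ b)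
    (hf : ∀ i x y, dist (f i x) (f i y) = c i * dist x y) {K : Set X} (hKd : ediam K ≠ ⊤)
    (hK : K = ⋃ i, f i '' K) {s : ℝ} (hs : 0 ≤ s) (hsum : ∑ i, c i ^ s = 1) :
    μH[s] K < ⊤ := by
  have hr : Tendsto (fun l : ℕ => ENNReal.ofReal b ^ l * ediam K) atTop (𝓝 0) := by
    simpa using ENNReal.Tendsto.mul_const
      (ENNReal.tendsto_pow_atTop_nhds_zero_of_lt_one (by simpa using hb1)) (Or.inr hKd)
  have h := Measure.hausdorffMeasure_le_liminf_sum (ι := fun l : ℕ => Fin l → Fin k) s K _ hr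
    (fun l v => piece f K (List.ofFn v))
    (.of_forall fun l v => (ediam_piece_le hf K _).trans <| by
      rw [← ENNReal.ofReal_pow hb0]
      gcongr
      simpa using wRatio_le_pow hc hb (List.ofFn v))
    (.of_forall fun l => subset_iUnion_piece_ofFn hK l)
  refine h.trans_lt (lt_of_le_of_lt ?_ (ENNReal.rpow_lt_top_of_nonneg hs hKd))
  refine (liminf_le_liminf (.of_forall fun l =>
    sum_ediam_piece_rpow_le hc hf K hs l)).trans ?_
  simp [hsum]

lemma hausdorffMeasure_eq_zero_of_H4_eq_zero {k : ℕ} {f : Fin k → X → X} {c : Fin k → ℝ}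
    (hc : ∀ i, 0 ≤ c i) {b : ℝ} (hb0 : 0 ≤ b) (hb1 : b < 1) (hb : ∀ i, c i ≤ b)
    (hf : ∀ i x y, dist (f i x) (f i y) = c i * dist x y) {K : Set X} (hKd : ediam K ≠ ⊤)
    {s : ℝ} (hH : H4 f K s = 0) : μH[s] K = 0 := by
  have hr : Tendsto (fun l : ℕ => ENNReal.ofReal b ^ l * ediam K) atTop (𝓝 0) := by
    simpa using ENNReal.Tendsto.mul_const
      (ENNReal.tendsto_pow_atTop_nhds_zero_of_lt_one (by simpa using hb1)) (Or.inr hKd)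
  have key : ∀ n : ℕ, ∃ 𝒜 : Finset (List (Fin k)), (∀ w ∈ 𝒜, n ≤ w.length) ∧
      (K ⊆ ⋃ w ∈ 𝒜, piece f K w) ∧ ∑ w ∈ 𝒜, ediam (piece f K w) ^ s < ((n : ENNReal) + 1)⁻¹ := by
    intro n
    have hn : H4n f K s n < ((n : ENNReal) + 1)⁻¹ := by
      have h0 : H4n f K s n = 0 := le_antisymm (hH ▸ le_iSup (H4n f K s) n) bot_le
      rw [h0]
      exact ENNReal.inv_pos.2 (by finiteness)
    simp only [H4n, iInf_lt_iff, exists_prop] at hn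
    exact hn
  choose 𝒜 hlen hcov hlt using key
  have h := Measure.hausdorffMeasure_le_liminf_sum (ι := fun n : ℕ => 𝒜 n) s K _ hr
    (fun n w => piece f K w)
    (.of_forall fun n w => (ediam_piece_le hf K _).trans <| by
      rw [← ENNReal.ofReal_pow hb0]
      gcongr
      exact (wRatio_le_pow hc hb _).trans
        (pow_le_pow_of_le_one hb0 hb1.le (hlen n w w.2)))
    (.of_forall fun n => by simpa [Set.iUnion_subtype] using hcov n)
  refine le_antisymm (h.trans ?_) bot_le
  have hlim : Tendsto (fun n : ℕ => ((n : ENNReal) + 1)⁻¹) atTop (𝓝 0) := by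
    simpa using (tendsto_add_atTop_iff_nat 1).2 ENNReal.tendsto_inv_nat_nhds_zero
  refine (liminf_le_liminf (.of_forall fun n => ?_)).trans hlim.liminf_eq.le
  rw [Finset.sum_coe_sort (𝒜 n) fun w => ediam (piece f K w) ^ s]
  exact (hlt n).le

end Hausdorff

section MassDistribution

variable {Y : Type*} [MeasurableSpace Y]

/-- The `n`-th iterate of the Hutchinson operator with weights `p`, applied to the Dirac mass
at `x₀`. -/
noncomputable def levelMeasure {k : ℕ} (f : Fin k → Y → Y) (p : Fin k → ℝ≥0∞) (x₀ : Y) :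
    ℕ → Measure Y
  | 0 => Measure.dirac x₀
  | n + 1 => ∑ i, p i • (levelMeasure f p x₀ n).map (f i)

lemma levelMeasure_succ_apply {k : ℕ} {f : Fin k → Y → Y} (hf : ∀ i, Measurable (f i))
    (p : Fin k → ℝ≥0∞) (x₀ : Y) (n : ℕ) {U : Set Y} (hU : MeasurableSet U) :
    levelMeasure f p x₀ (n + 1) U = ∑ i, p i * levelMeasure f p x₀ n (f i ⁻¹' U) := by
  simp [levelMeasure, Measure.map_apply (hf _) hU]

lemma levelMeasure_univ {k : ℕ} {f : Fin k → Y → Y} (hf : ∀ i, Measurable (f i))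
    {p : Fin k → ℝ≥0∞} (hp : ∑ i, p i = 1) (x₀ : Y) (n : ℕ) :
    levelMeasure f p x₀ n Set.univ = 1 := by
  induction n with
  | zero => simp [levelMeasure]
  | succ n ih => simp [levelMeasure_succ_apply hf p x₀ n .univ, ih, hp]

lemma levelMeasure_eq_zero_of_disjoint {k : ℕ} {f : Fin k → Y → Y}
    (hf : ∀ i, Measurable (f i)) (p : Fin k → ℝ≥0∞) {x₀ : Y} {K : Set Y} (hx₀ : x₀ ∈ K)
    (hK : ∀ i, f i '' K ⊆ K) (n : ℕ) {U : Set Y} (hU : MeasurableSet U) (hKU : Disjoint K U) :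
    levelMeasure f p x₀ n U = 0 := by
  induction n generalizing U with
  | zero => simp [levelMeasure, Measure.dirac_apply' _ hU, Set.disjoint_left.1 hKU hx₀]
  | succ n ih =>
    rw [levelMeasure_succ_apply hf p x₀ n hU]
    refine Finset.sum_eq_zero fun i _ => ?_
    rw [ih (hf i hU), mul_zero]
    exact Set.disjoint_left.2 fun x hx hxU =>
      Set.disjoint_left.1 hKU (hK i (Set.mem_image_of_mem _ hx)) hxU

/-- The mass of `U` is carried by an antichain of words of ratio comparable to `δ` whose pieces
meet `U`. -/
lemma exists_finset_levelMeasure_le {k : ℕ} {f : Fin k → Y → Y} {c : Fin k → ℝ} {a b α : ℝ}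
    (ha : 0 < a) (hca : ∀ i, a ≤ c i) (hcb : ∀ i, c i ≤ b)
    (hsum : ∑ i, c i ^ α = 1) (hfm : ∀ i, Measurable (f i))
    (hfi : ∀ i, Function.Injective (f i))
    {K V : Set Y} {x₀ : Y} (hx₀ : x₀ ∈ K) (hK : ∀ i, f i '' K ⊆ K) (hV : ∀ i, f i '' V ⊆ V)
    (hVd : ∀ i j, i ≠ j → Disjoint (f i '' V) (f j '' V)) (n : ℕ) {δ : ℝ} (hδ : 0 < δ)
    (hδa : a * δ ≤ 1) (hδn : b ^ n ≤ δ) {U : Set Y} (hU : MeasurableSet U) :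
    ∃ T : Finset (List (Fin k)),
      (∀ w ∈ T, wRatio c w ≤ δ ∧ a * δ ≤ wRatio c w ∧ (piece f K w ∩ U).Nonempty) ∧
      ((T : Set (List (Fin k))).PairwiseDisjoint fun w => wMap f w '' V) ∧
      levelMeasure f (fun i => ENNReal.ofReal (c i ^ α)) x₀ n U ≤
        ∑ w ∈ T, ENNReal.ofReal (wRatio c w ^ α) := by
  classical
  have hc : ∀ i, 0 < c i := fun i => ha.trans_le (hca i)
  have hp : ∑ i, ENNReal.ofReal (c i ^ α) = 1 := by
    rw [← ENNReal.ofReal_sum_of_nonneg fun i _ => Real.rpow_nonneg (hc i).le _, hsum,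
      ENNReal.ofReal_one]
  have coarse : ∀ (n : ℕ) {δ : ℝ}, 1 ≤ δ → a * δ ≤ 1 → ∀ {U : Set Y}, MeasurableSet U →
      ∃ T : Finset (List (Fin k)),
      (∀ w ∈ T, wRatio c w ≤ δ ∧ a * δ ≤ wRatio c w ∧ (piece f K w ∩ U).Nonempty) ∧
      ((T : Set (List (Fin k))).PairwiseDisjoint fun w => wMap f w '' V) ∧
      levelMeasure f (fun i => ENNReal.ofReal (c i ^ α)) x₀ n U ≤
        ∑ w ∈ T, ENNReal.ofReal (wRatio c w ^ α) := by
    intro n δ h1 hδa U hU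
    by_cases hKU : Disjoint K U
    · exact ⟨∅, by simp, by simp,
        (levelMeasure_eq_zero_of_disjoint hfm _ hx₀ hK n hU hKU).le.trans bot_le⟩
    · refine ⟨{[]}, ?_, by simp, ?_⟩
      · simpa [h1, hδa, piece, wMap] using Set.not_disjoint_iff_nonempty_inter.1 hKU
      · simpa using (measure_mono (Set.subset_univ U)).trans (levelMeasure_univ hfm hp x₀ n).le
  induction n generalizing δ U with
  | zero => exact coarse 0 (by simpa using hδn) hδa hU
  | succ n ih =>
    by_cases h1 : 1 ≤ δ
    · exact coarse (n + 1) h1 hδa hU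
    have step : ∀ i, ∃ T : Finset (List (Fin k)),
        (∀ w ∈ T, wRatio c w ≤ δ / c i ∧ a * (δ / c i) ≤ wRatio c w ∧
          (piece f K w ∩ f i ⁻¹' U).Nonempty) ∧
        ((T : Set (List (Fin k))).PairwiseDisjoint fun w => wMap f w '' V) ∧
        levelMeasure f (fun i => ENNReal.ofReal (c i ^ α)) x₀ n (f i ⁻¹' U) ≤
          ∑ w ∈ T, ENNReal.ofReal (wRatio c w ^ α) := by
      intro i
      have hb0 : 0 < b := (hc i).trans_le (hcb i)
      refine ih (div_pos hδ (hc i)) ?_ ?_ (hfm i hU)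
      · rw [← mul_div_assoc, div_le_one (hc i)]
        nlinarith [hca i]
      · rw [le_div_iff₀ (hc i)]
        refine le_trans ?_ hδn
        rw [pow_succ]
        gcongr
        exact hcb i
    choose T hT hTd hTm using step
    refine ⟨Finset.univ.biUnion fun i => (T i).image (List.cons i), ?_, ?_, ?_⟩
    · simp only [Finset.mem_biUnion, Finset.mem_univ, true_and, Finset.mem_image]
      rintro _ ⟨i, w, hw, rfl⟩
      obtain ⟨h₁, h₂, x, hx, hxU⟩ := hT i w hw
      refine ⟨?_, ?_, f i x, ?_, hxU⟩
      · rw [wRatio_cons, mul_comm]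
        exact (le_div_iff₀ (hc i)).1 h₁
      · rw [← mul_div_assoc, div_le_iff₀ (hc i)] at h₂
        rwa [wRatio_cons, mul_comm (c i)]
      · rw [piece_cons]
        exact Set.mem_image_of_mem _ hx
    · intro u hu v hv huv
      simp only [Finset.coe_biUnion, Set.mem_iUnion, Finset.coe_image, Finset.coe_univ,
        Set.mem_univ, exists_true_left] at hu hv
      obtain ⟨i, w, hw, rfl⟩ := hu
      obtain ⟨j, w', hw', rfl⟩ := hv
      simp only [Function.onFun, wMap, Set.image_comp]
      by_cases hij : i = j
      · subst hij
        exact (Set.disjoint_image_iff (hfi i)).2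
          (hTd i hw hw' fun h => huv (by rw [h]))
      · exact (hVd i j hij).mono (Set.image_mono (wMap_mapsTo hV w))
          (Set.image_mono (wMap_mapsTo hV w'))
    · rw [levelMeasure_succ_apply hfm _ x₀ n hU, Finset.sum_biUnion]
      · refine Finset.sum_le_sum fun i _ => ?_
        rw [Finset.sum_image fun _ _ _ _ h => (List.cons.inj h).2]
        refine (mul_le_mul_right (hTm i) _).trans ?_
        rw [Finset.mul_sum]
        refine Finset.sum_le_sum fun w _ => ?_
        rw [wRatio_cons, Real.mul_rpow (hc i).le (wRatio_nonneg (fun i => (hc i).le) w),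
          ENNReal.ofReal_mul (Real.rpow_nonneg (hc i).le _)]
      · intro i _ j _ hij
        refine Finset.disjoint_left.2 fun w hw hw' => hij ?_
        obtain ⟨u, -, rfl⟩ := Finset.mem_image.1 hw
        obtain ⟨v, -, h⟩ := Finset.mem_image.1 hw'
        exact (List.cons.inj h).1.symm

end MassDistribution

lemma ball_subset_image_of_dist_eq {g : X → X} (hg : Function.Surjective g) {ρ : ℝ} (hρ : 0 < ρ)
    (h : ∀ x y, dist (g x) (g y) = ρ * dist x y) (z : X) (r : ℝ) :
    ball (g z) (ρ * r) ⊆ g '' ball z r := by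
  intro y hy
  obtain ⟨x, rfl⟩ := hg y
  rw [mem_ball, h] at hy
  exact ⟨x, lt_of_mul_lt_mul_left hy hρ.le, rfl⟩

lemma surjective_of_dist_eq {E : Type*} [NormedAddCommGroup E] [NormedSpace ℝ E]
    [StrictConvexSpace ℝ E] [FiniteDimensional ℝ E] {g : E → E} {ρ : ℝ} (hρ : 0 < ρ)
    (h : ∀ x y, dist (g x) (g y) = ρ * dist x y) : Function.Surjective g := by
  have hi : Isometry fun x => ρ⁻¹ • g x := Isometry.of_dist_eq fun x y => by
    rw [dist_smul₀, h, Real.norm_of_nonneg (inv_nonneg.2 hρ.le), inv_mul_cancel_left₀ hρ.ne']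
  have hs : Function.Surjective fun x => ρ⁻¹ • g x := by
    have hl : Function.Surjective hi.affineIsometryOfStrictConvexSpace.linear :=
      LinearMap.injective_iff_surjective.1
        hi.affineIsometryOfStrictConvexSpace.linearIsometry.injective
    exact (AffineMap.linear_surjective_iff _).1 hl
  intro y
  obtain ⟨x, hx⟩ := hs (ρ⁻¹ • y)
  exact ⟨x, smul_right_injective E (inv_ne_zero hρ.ne') hx⟩

/-- Volume bound for the number of disjoint balls of radius at least `r` inside a ball. -/
lemma card_mul_pow_le_of_pairwiseDisjoint_ball {E ι : Type*} [NormedAddCommGroup E]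
    [NormedSpace ℝ E] [FiniteDimensional ℝ E] (T : Finset ι) (x : ι → E) (y : E) {r R : ℝ}
    (hr : 0 < r) (hR : 0 < R) (hd : (T : Set ι).PairwiseDisjoint fun i => ball (x i) r)
    (hsub : ∀ i ∈ T, ball (x i) r ⊆ ball y R) :
    (T.card : ℝ) * r ^ Module.finrank ℝ E ≤ R ^ Module.finrank ℝ E := by
  borelize E
  set μ : Measure E := Measure.addHaar
  have h : ∑ i ∈ T, μ (ball (x i) r) ≤ μ (ball y R) := by
    rw [← measure_biUnion_finset hd fun i _ => measurableSet_ball]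
    exact measure_mono (Set.iUnion₂_subset hsub)
  simp only [Measure.addHaar_ball_of_pos μ _ hr, Measure.addHaar_ball_of_pos μ _ hR,
    Finset.sum_const, nsmul_eq_mul, ← mul_assoc] at h
  rw [ENNReal.mul_le_mul_iff_left (measure_ball_pos μ _ one_pos).ne' measure_ball_lt_top.ne,
    ← ENNReal.ofReal_natCast, ← ENNReal.ofReal_mul (Nat.cast_nonneg _)] at h
  exact (ENNReal.ofReal_le_ofReal_iff (by positivity)).1 h

/-- Frostman-type estimate for the level measures under the open set condition. -/
lemma exists_levelMeasure_ball_le {E : Type*} [NormedAddCommGroup E] [NormedSpace ℝ E]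
    [StrictConvexSpace ℝ E] [FiniteDimensional ℝ E] [MeasurableSpace E] [BorelSpace E]
    {k : ℕ} {f : Fin k → E → E} {c : Fin k → ℝ} {a b α : ℝ}
    (ha : 0 < a) (ha1 : a ≤ 1) (hca : ∀ i, a ≤ c i) (hcb : ∀ i, c i ≤ b) (hα : 0 ≤ α)
    (hsum : ∑ i, c i ^ α = 1) (hf : ∀ i x y, dist (f i x) (f i y) = c i * dist x y)
    {K V : Set E} {x₀ : E} (hx₀ : x₀ ∈ K) (hKb : Bornology.IsBounded K)
    (hK : ∀ i, f i '' K ⊆ K) (hVne : V.Nonempty) (hVo : IsOpen V) (hV : ∀ i, f i '' V ⊆ V)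
    (hVd : ∀ i j, i ≠ j → Disjoint (f i '' V) (f j '' V)) :
    ∃ M : ℝ, ∀ (n : ℕ) (δ : ℝ), 0 < δ → δ ≤ 1 → b ^ n ≤ δ → ∀ y : E,
      levelMeasure f (fun i => ENNReal.ofReal (c i ^ α)) x₀ n (ball y δ) ≤
        ENNReal.ofReal M * ENNReal.ofReal (δ ^ α) := by
  have hc : ∀ i, 0 < c i := fun i => ha.trans_le (hca i)
  have hfi : ∀ i, Function.Injective (f i) := fun i x y hxy => by
    have h := hf i x y
    rw [hxy, dist_self] at h
    exact dist_eq_zero.1 ((mul_eq_zero.1 h.symm).resolve_left (hc i).ne')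
  have hfm : ∀ i, Measurable (f i) := fun i =>
    (LipschitzWith.of_dist_le_mul (K := (c i).toNNReal) fun x y => by
      rw [hf, Real.coe_toNNReal _ (hc i).le]).continuous.measurable
  obtain ⟨z, hz⟩ := hVne
  obtain ⟨r, hr, hrV⟩ := Metric.isOpen_iff.1 hVo z hz
  obtain ⟨D, hD0, hD⟩ := hKb.subset_closedBall_lt 0 z
  set m := Module.finrank ℝ E
  refine ⟨((a * r + D + 1) / (a * r)) ^ m, fun n δ hδ hδ1 hδn y => ?_⟩
  obtain ⟨T, hT, hTd, hTm⟩ := exists_finset_levelMeasure_le ha hca hcb hsum hfm hfi hx₀ hK hV hVd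
    n hδ (by nlinarith) hδn (U := ball y δ) measurableSet_ball
  have hcard : (T.card : ℝ) * (a * δ * r) ^ m ≤ (δ * (a * r + D + 1)) ^ m := by
    refine card_mul_pow_le_of_pairwiseDisjoint_ball T (fun w => wMap f w z) y (by positivity)
      (by positivity) ?_ ?_
    · refine hTd.mono_on fun w hw => ?_
      have h2 := (hT w hw).2.1
      refine Set.Subset.trans ?_ ((ball_subset_image_of_dist_eq
        (wMap_surjective (fun i => surjective_of_dist_eq (hc i) (hf i)) w)
        ((by positivity : 0 < a * δ).trans_le h2) (dist_wMap hf w) z r).trans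
        (Set.image_mono hrV))
      exact ball_subset_ball (mul_le_mul_of_nonneg_right h2 hr.le)
    · intro w hw x hx
      obtain ⟨h1, h2, _, ⟨q, hq, rfl⟩, hqy⟩ := hT w hw
      have hqz : dist (wMap f w z) (wMap f w q) ≤ δ * D := by
        rw [dist_wMap hf, dist_comm]
        exact mul_le_mul h1 (hD hq) dist_nonneg hδ.le
      have h3 := dist_triangle4 x (wMap f w z) (wMap f w q) y
      rw [mem_ball] at hx hqy ⊢
      nlinarith
  have hcard' : (T.card : ℝ) ≤ ((a * r + D + 1) / (a * r)) ^ m := by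
    rw [div_pow, le_div_iff₀ (by positivity)]
    refine le_of_mul_le_mul_right ?_ (pow_pos hδ m)
    calc (T.card : ℝ) * (a * r) ^ m * δ ^ m = T.card * (a * δ * r) ^ m := by
          rw [mul_assoc, ← mul_pow]; ring_nf
      _ ≤ _ := hcard
      _ = _ := by rw [← mul_pow]; ring_nf
  refine hTm.trans ?_
  calc ∑ w ∈ T, ENNReal.ofReal (wRatio c w ^ α) ≤ ∑ w ∈ T, ENNReal.ofReal (δ ^ α) :=
        Finset.sum_le_sum fun w hw => ENNReal.ofReal_le_ofReal <|
          Real.rpow_le_rpow (wRatio_nonneg (fun i => (hc i).le) w) (hT w hw).1 hα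
    _ = ENNReal.ofReal T.card * ENNReal.ofReal (δ ^ α) := by
        rw [Finset.sum_const, nsmul_eq_mul, ENNReal.ofReal_natCast]
    _ ≤ _ := by gcongr

lemma exists_ofReal_rpow_le_add {D : ℝ≥0∞} (hD : D < 1) {α : ℝ} (hα : 0 < α) {ε : ℝ≥0∞}
    (hε : 0 < ε) :
    ∃ δ : ℝ, 0 < δ ∧ δ ≤ 1 ∧ D < ENNReal.ofReal δ ∧ ENNReal.ofReal (δ ^ α) ≤ D ^ α + ε := by
  have hDα : D ^ α < D ^ α + ε :=
    ENNReal.lt_add_right (ENNReal.rpow_ne_top_of_nonneg hα.le (hD.trans ENNReal.one_lt_top).ne)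
      hε.ne'
  have h := ((ENNReal.continuous_rpow_const (y := α)).tendsto D).eventually (gt_mem_nhds hDα)
  obtain ⟨u, hDu, hu⟩ := (mem_nhdsGT_iff_exists_Ioo_subset' hD).1 (nhdsWithin_le_nhds h)
  obtain ⟨t, ht, htu⟩ := exists_between (lt_min hDu hD)
  have htop : t ≠ ⊤ := (htu.trans_le (min_le_right _ _)).ne_top
  have ht1 : t < 1 := htu.trans_le (min_le_right _ _)
  refine ⟨t.toReal, ENNReal.toReal_pos (bot_le.trans_lt ht).ne' htop, ?_, ?_, ?_⟩
  · simpa using ENNReal.toReal_mono ENNReal.one_ne_top ht1.le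
  · rwa [ENNReal.ofReal_toReal htop]
  · rw [← ENNReal.ofReal_rpow_of_nonneg ENNReal.toReal_nonneg hα.le, ENNReal.ofReal_toReal htop]
    exact (hu ⟨ht, htu.trans_le (min_le_left _ _)⟩).le

/-- Mass distribution principle for the sequence of level measures on a compact set. -/
lemma hausdorffMeasure_ne_zero_of_levelMeasure_ball_le [MeasurableSpace X] [BorelSpace X]
    {k : ℕ} {f : Fin k → X → X} (hf : ∀ i, Measurable (f i)) {p : Fin k → ℝ≥0∞}
    (hp : ∑ i, p i = 1) {K : Set X} {x₀ : X} (hx₀ : x₀ ∈ K) (hKc : IsCompact K)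
    (hK : ∀ i, f i '' K ⊆ K) {b : ℝ} (hb0 : 0 ≤ b) (hb1 : b < 1) {α : ℝ} (hα : 0 < α) {M : ℝ}
    (hM : ∀ (n : ℕ) (δ : ℝ), 0 < δ → δ ≤ 1 → b ^ n ≤ δ → ∀ y : X,
      levelMeasure f p x₀ n (ball y δ) ≤ ENNReal.ofReal M * ENNReal.ofReal (δ ^ α)) :
    μH[α] K ≠ 0 := by
  intro h0
  obtain ⟨ε, hε, hεM⟩ : ∃ ε : ℝ≥0∞, 0 < ε ∧ ENNReal.ofReal M * (ε + ε) < 1 := by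
    have hlim : Tendsto (fun ε : ℝ≥0∞ => ENNReal.ofReal M * (ε + ε)) (𝓝 0) (𝓝 0) := by
      have := ENNReal.Tendsto.const_mul (a := ENNReal.ofReal M)
        ((tendsto_id (x := 𝓝 (0 : ℝ≥0∞))).add tendsto_id) (Or.inr ENNReal.ofReal_ne_top)
      simpa using this
    have hev : ∀ᶠ ε in 𝓝[>] (0 : ℝ≥0∞), ENNReal.ofReal M * (ε + ε) < 1 :=
      nhdsWithin_le_nhds (hlim.eventually (gt_mem_nhds one_pos))
    obtain ⟨ε, h1, h2⟩ := (hev.and self_mem_nhdsWithin).exists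
    exact ⟨ε, h2, h1⟩
  obtain ⟨t, hKt, htd, hts⟩ : ∃ t : ℕ → Set X, K ⊆ ⋃ n, t n ∧ (∀ n, ediam (t n) ≤ 2⁻¹) ∧
      ∑' n, ⨆ _ : (t n).Nonempty, ediam (t n) ^ α < ε := by
    have h : (⨅ (t : ℕ → Set X) (_ : K ⊆ ⋃ n, t n) (_ : ∀ n, ediam (t n) ≤ 2⁻¹),
        ∑' n, ⨆ _ : (t n).Nonempty, ediam (t n) ^ α) < ε := by
      refine lt_of_le_of_lt ?_ hε
      rw [← h0, Measure.hausdorffMeasure_apply]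
      exact le_iSup₂_of_le (2⁻¹ : ℝ≥0∞) (by simp) le_rfl
    simpa only [iInf_lt_iff, exists_prop] using h
  obtain ⟨η, hη, hηs⟩ := ENNReal.exists_pos_sum_of_countable' hε.ne' ℕ
  have key : ∀ n, ∃ (y : X) (δ : ℝ), 0 < δ ∧ δ ≤ 1 ∧ t n ⊆ ball y δ ∧
      ENNReal.ofReal (δ ^ α) ≤ (⨆ _ : (t n).Nonempty, ediam (t n) ^ α) + η n := by
    intro n
    rcases (t n).eq_empty_or_nonempty with h | h
    · obtain ⟨δ, hδ0, hδ1, -, hδ⟩ := exists_ofReal_rpow_le_add (zero_lt_one) hα (hη n)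
      exact ⟨x₀, δ, hδ0, hδ1, by simp [h], by simpa [h, hα] using hδ⟩
    · obtain ⟨δ, hδ0, hδ1, hδd, hδ⟩ := exists_ofReal_rpow_le_add
        ((htd n).trans_lt ENNReal.one_half_lt_one) hα (hη n)
      obtain ⟨y, hy⟩ := h
      refine ⟨y, δ, hδ0, hδ1, fun x hx => ?_, by simpa [Set.nonempty_of_mem hy] using hδ⟩
      rw [← Metric.eball_ofReal]
      exact (edist_le_ediam_of_mem hx hy).trans_lt hδd
  choose y δ hδ0 hδ1 hδt hδ using key
  obtain ⟨s, hs⟩ := hKc.elim_finite_subcover (fun n => ball (y n) (δ n)) (fun n => isOpen_ball)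
    (hKt.trans (Set.iUnion_mono hδt))
  obtain ⟨N, hN⟩ : ∃ N : ℕ, ∀ n ∈ s, b ^ N ≤ δ n :=
    ((eventually_all_finset s).2 fun n _ =>
      (tendsto_pow_atTop_nhds_zero_of_lt_one hb0 hb1).eventually_le_const (hδ0 n)).exists
  have hKone : 1 ≤ levelMeasure f p x₀ N K := by
    rw [← levelMeasure_univ hf hp x₀ N, ← Set.union_compl_self K]
    refine (measure_union_le _ _).trans ?_
    rw [levelMeasure_eq_zero_of_disjoint hf p hx₀ hK N hKc.measurableSet.compl
      disjoint_compl_right, add_zero]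
  refine absurd hεM (not_lt.2 (hKone.trans ?_))
  calc levelMeasure f p x₀ N K ≤ ∑ n ∈ s, levelMeasure f p x₀ N (ball (y n) (δ n)) :=
        (measure_mono hs).trans (measure_biUnion_finset_le s _)
    _ ≤ ∑ n ∈ s, ENNReal.ofReal M * ENNReal.ofReal (δ n ^ α) :=
        Finset.sum_le_sum fun n hn => hM N _ (hδ0 n) (hδ1 n) (hN n hn) _
    _ = ENNReal.ofReal M * ∑ n ∈ s, ENNReal.ofReal (δ n ^ α) := by rw [Finset.mul_sum]
    _ ≤ ENNReal.ofReal M *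
        ∑' n, ((⨆ _ : (t n).Nonempty, ediam (t n) ^ α) + η n) := by
        gcongr
        exact (Finset.sum_le_sum fun n _ => hδ n).trans (ENNReal.sum_le_tsum s)
    _ ≤ _ := by
        rw [ENNReal.tsum_add]
        gcongr

lemma csInf_eq_of_Ioi_subset_of_subset_Ici {S : Set ℝ} {α : ℝ} (h₁ : Set.Ioi α ⊆ S)
    (h₂ : S ⊆ Set.Ici α) : sInf S = α :=
  csInf_eq_of_forall_ge_of_forall_gt_exists_lt (Set.nonempty_Ioi.mono h₁) h₂ fun w hw => by
    obtain ⟨u, hu, huw⟩ := exists_between hw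
    exact ⟨u, h₁ hu, huw⟩

theorem stmt_1 {d : ℕ} {k : ℕ} (hk : 2 ≤ k)
    (f : Fin k → EuclideanSpace ℝ (Fin d) → EuclideanSpace ℝ (Fin d)) (c : Fin k → ℝ)
    (hc : ∀ i, c i ∈ Set.Ioo (0 : ℝ) 1)
    (hf : ∀ i x y, dist (f i x) (f i y) = c i * dist x y)
    (K : Set (EuclideanSpace ℝ (Fin d))) (hKne : K.Nonempty) (hKcp : IsCompact K)
    (hK : K = ⋃ i, f i '' K)
    (α : ℝ) (hα : 0 < α) (hαsum : ∑ i, c i ^ α = 1)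
    (hOSC : ∃ V : Set (EuclideanSpace ℝ (Fin d)), V.Nonempty ∧ IsOpen V ∧
      (∀ i, f i '' V ⊆ V) ∧ ∀ i j, i ≠ j → Disjoint (f i '' V) (f j '' V)) :
    dimH K = ENNReal.ofReal α ∧ dim4 f K = α ∧ dim3 f K = α := by
  obtain ⟨V, hVne, hVo, hV, hVd⟩ := hOSC
  obtain ⟨x₀, hx₀⟩ := hKne
  have : Nonempty (Fin k) := ⟨⟨0, by omega⟩⟩
  obtain ⟨imin, himin⟩ := Finite.exists_min c
  obtain ⟨imax, himax⟩ := Finite.exists_max c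
  have hc0 : ∀ i, 0 ≤ c i := fun i => (hc i).1.le
  have hKsub : ∀ i, f i '' K ⊆ K := fun i => by
    conv_rhs => rw [hK]
    exact Set.subset_iUnion (fun i => f i '' K) i
  have hKd : ediam K ≠ ⊤ := hKcp.isBounded.ediam_ne_top
  have hp : ∑ i, ENNReal.ofReal (c i ^ α) = 1 := by
    rw [← ENNReal.ofReal_sum_of_nonneg fun i _ => Real.rpow_nonneg (hc0 i) _, hαsum,
      ENNReal.ofReal_one]
  have hfm : ∀ i, Measurable (f i) := fun i =>
    (LipschitzWith.of_dist_le_mul (K := (c i).toNNReal) fun x y => by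
      rw [hf, Real.coe_toNNReal _ (hc0 i)]).continuous.measurable
  obtain ⟨M, hM⟩ := exists_levelMeasure_ball_le (hc imin).1 (hc imin).2.le himin himax hα.le hαsum
    hf hx₀ hKcp.isBounded hKsub hVne hVo hV hVd
  have hpos : μH[α] K ≠ 0 := hausdorffMeasure_ne_zero_of_levelMeasure_ball_le hfm hp hx₀ hKcp
    hKsub (hc0 imax) (hc imax).2 hα hM
  have hfin : μH[α] K < ⊤ := hausdorffMeasure_lt_top_of_sum_eq_one hc0 (hc0 imax) (hc imax).2
    himax hf hKd hK hα.le hαsum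
  have hdim : dimH K = ENNReal.ofReal α := by
    lift α to NNReal using hα.le
    rw [ENNReal.ofReal_coe_nnreal]
    exact dimH_of_hausdorffMeasure_ne_zero_ne_top hpos hfin.ne
  have hH3 : ∀ s, α < s → 0 ≤ s ∧ H3 f K s = 0 := fun s hs => by
    refine ⟨(hα.trans hs).le, H3_eq_zero hc0 hf hKd (hα.trans hs).le ?_⟩
    rw [← hαsum]
    exact Finset.sum_lt_sum_of_nonempty Finset.univ_nonempty fun i _ =>
      Real.rpow_lt_rpow_of_exponent_gt (hc i).1 (hc i).2 hs
  have hH43 : ∀ s, H3 f K s = 0 → H4 f K s = 0 := fun s hs =>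
    le_antisymm (hs ▸ H4_le_H3 hK s) bot_le
  have hH4 : ∀ s, 0 ≤ s → H4 f K s = 0 → α ≤ s := fun s hs0 hs => by
    have h0 := hausdorffMeasure_eq_zero_of_H4_eq_zero hc0 (hc0 imax) (hc imax).2 himax hf hKd hs
    lift s to NNReal using hs0
    have h := dimH_le_of_hausdorffMeasure_ne_top (h0.trans_ne ENNReal.zero_ne_top)
    rw [hdim, ENNReal.ofReal_le_iff_le_toReal ENNReal.coe_ne_top] at h
    exact h
  exact ⟨hdim,
    csInf_eq_of_Ioi_subset_of_subset_Ici (fun s hs => ⟨(hH3 s hs).1, hH43 s (hH3 s hs).2⟩)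
      fun s hs => hH4 s hs.1 hs.2,
    csInf_eq_of_Ioi_subset_of_subset_Ici (fun s hs => hH3 s hs)
      fun s hs => hH4 s hs.1 (hH43 s hs.2)⟩

end IFSMoran
end

section
/- Let K be the attractor of an IFS of similitudes on a complete metric space with similarity dimension α, endowed with its natural fractal structure. If dim⁴(K) = dim³(K) = α, then the natural fractal structure is irreducible. -/
open scoped ENNReal

namespace IFSMoran

variable {X : Type*} [MetricSpace X]

open scoped NNReal

theorem wMap_append {Y : Type*} {k : ℕ} (f : Fin k → Y → Y) (u v : List (Fin k)) :
    wMap f (u ++ v) = wMap f u ∘ wMap f v := by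
  induction u with
  | nil => rfl
  | cons i u ih => simp [wMap, ih, Function.comp_assoc]

theorem piece_append {Y : Type*} {k : ℕ} (f : Fin k → Y → Y) (K : Set Y) (u v : List (Fin k)) :
    piece f K (u ++ v) = wMap f u '' piece f K v := by
  simp only [piece, wMap_append, Set.image_comp]

/-- The multiplicative weight of a word, with letter weights `c i ^ s`. -/
noncomputable def wordWeight {k : ℕ} (c : Fin k → ℝ≥0) (s : ℝ) (w : List (Fin k)) : ℝ≥0 :=
  (w.map fun i => c i ^ s).prod

theorem wordWeight_append {k : ℕ} (c : Fin k → ℝ≥0) (s : ℝ) (u v : List (Fin k)) :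
    wordWeight c s (u ++ v) = wordWeight c s u * wordWeight c s v := by
  simp [wordWeight]

theorem wordWeight_eq_rpow {k : ℕ} (c : Fin k → ℝ≥0) (s : ℝ) (w : List (Fin k)) :
    wordWeight c s w = (w.map c).prod ^ s := by
  induction w with
  | nil => simp [wordWeight]
  | cons i w ih =>
    simp only [wordWeight, List.map_cons, List.prod_cons, NNReal.mul_rpow] at ih ⊢
    rw [ih]

theorem lipschitzWith_wMap {k : ℕ} {f : Fin k → X → X} {c : Fin k → ℝ≥0}
    (hf : ∀ i, LipschitzWith (c i) (f i)) (w : List (Fin k)) :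
    LipschitzWith (w.map c).prod (wMap f w) := by
  induction w with
  | nil => simpa [wMap] using LipschitzWith.id
  | cons i w ih => simpa [wMap] using (hf i).comp ih

theorem ediam_piece_rpow_le {k : ℕ} {f : Fin k → X → X} {c : Fin k → ℝ≥0}
    (hf : ∀ i, LipschitzWith (c i) (f i)) (K : Set X) {s : ℝ} (hs : 0 ≤ s)
    (w : List (Fin k)) :
    Metric.ediam (piece f K w) ^ s ≤ wordWeight c s w * Metric.ediam K ^ s := by
  rw [wordWeight_eq_rpow, ENNReal.coe_rpow_of_nonneg _ hs, ← ENNReal.mul_rpow_of_nonneg _ _ hs]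
  exact ENNReal.rpow_le_rpow ((lipschitzWith_wMap hf w).ediam_image_le K) hs

/-- The words of length `l`. -/
def wordsOfLength (k l : ℕ) : Finset (List (Fin k)) :=
  (Finset.univ : Finset (Fin l → Fin k)).map ⟨List.ofFn, List.ofFn_injective⟩

theorem mem_wordsOfLength {k l : ℕ} {w : List (Fin k)} :
    w ∈ wordsOfLength k l ↔ w.length = l := by
  simp only [wordsOfLength, Finset.mem_map, Finset.mem_univ, true_and, Function.Embedding.coeFn_mk]
  constructor
  · rintro ⟨v, rfl⟩
    simp
  · rintro rfl
    exact ⟨w.get, List.ofFn_get w⟩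

theorem sum_wordsOfLength {k : ℕ} (c : Fin k → ℝ≥0) (s : ℝ) (l : ℕ) :
    ∑ w ∈ wordsOfLength k l, wordWeight c s w = (∑ i, c i ^ s) ^ l := by
  simp [wordsOfLength, wordWeight, Fintype.sum_pow, List.map_ofFn, List.prod_ofFn]

theorem subset_iUnion_wordsOfLength {Y : Type*} {k : ℕ} {f : Fin k → Y → Y} {K : Set Y}
    (hK : K = ⋃ i, f i '' K) (l : ℕ) :
    K ⊆ ⋃ w ∈ wordsOfLength k l, piece f K w := by
  induction l with
  | zero =>
    intro x hx
    simp only [Set.mem_iUnion, mem_wordsOfLength]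
    exact ⟨[], rfl, x, hx, rfl⟩
  | succ l ih =>
    intro x hx
    rw [hK] at hx
    obtain ⟨i, y, hy, rfl⟩ := Set.mem_iUnion.1 hx
    have := ih hy
    simp only [Set.mem_iUnion, mem_wordsOfLength] at this ⊢
    obtain ⟨w, hw, z, hz, rfl⟩ := this
    exact ⟨i :: w, by simp [hw], z, hz, rfl⟩

/-- A covering of `K` by pieces of nonempty words can be iterated, multiplying the weights. -/
theorem exists_iterated_cover {Y : Type*} {k : ℕ} {f : Fin k → Y → Y} {K : Set Y}
    (c : Fin k → ℝ≥0) (s : ℝ)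
    {S : Finset (List (Fin k))} (hS : ∀ w ∈ S, 1 ≤ w.length)
    (hcov : K ⊆ ⋃ w ∈ S, piece f K w) (n : ℕ) :
    ∃ T : Finset (List (Fin k)), (∀ w ∈ T, n ≤ w.length) ∧ (K ⊆ ⋃ w ∈ T, piece f K w) ∧
      ∑ w ∈ T, wordWeight c s w ≤ (∑ w ∈ S, wordWeight c s w) ^ n := by
  induction n with
  | zero => exact ⟨{[]}, by simp, by simp [piece, wMap], by simp [wordWeight]⟩
  | succ n ih =>
    obtain ⟨T, hlen, hT, hsum⟩ := ih
    refine ⟨(S ×ˢ T).image fun p => p.1 ++ p.2, ?_, ?_, ?_⟩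
    · simp only [Finset.mem_image, Finset.mem_product]
      rintro _ ⟨p, ⟨h₁, h₂⟩, rfl⟩
      have := hS _ h₁
      have := hlen _ h₂
      simp only [List.length_append]
      omega
    · intro x hx
      have hx := hcov hx
      simp only [Set.mem_iUnion] at hx
      obtain ⟨u, hu, y, hy, rfl⟩ := hx
      have hy := hT hy
      simp only [Set.mem_iUnion] at hy ⊢
      obtain ⟨v, hv, hy⟩ := hy
      refine ⟨u ++ v, Finset.mem_image.2 ⟨(u, v), Finset.mem_product.2 ⟨hu, hv⟩, rfl⟩, ?_⟩
      rw [piece_append]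
      exact ⟨y, hy, rfl⟩
    · calc ∑ w ∈ (S ×ˢ T).image fun p => p.1 ++ p.2, wordWeight c s w
          ≤ ∑ p ∈ S ×ˢ T, wordWeight c s (p.1 ++ p.2) :=
            Finset.sum_image_le_of_nonneg fun _ _ => zero_le
        _ = (∑ w ∈ S, wordWeight c s w) * ∑ w ∈ T, wordWeight c s w := by
            simp only [wordWeight_append, Finset.sum_mul_sum, Finset.sum_product]
        _ ≤ (∑ w ∈ S, wordWeight c s w) * (∑ w ∈ S, wordWeight c s w) ^ n := by gcongr
        _ = (∑ w ∈ S, wordWeight c s w) ^ (n + 1) := (pow_succ' _ _).symm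

theorem H4_eq_zero_of_cover {k : ℕ} {f : Fin k → X → X} {c : Fin k → ℝ≥0}
    (hf : ∀ i, LipschitzWith (c i) (f i)) {K : Set X} (hKb : Metric.ediam K ≠ ∞)
    {s : ℝ} (hs : 0 ≤ s) {S : Finset (List (Fin k))} (hS : ∀ w ∈ S, 1 ≤ w.length)
    (hcov : K ⊆ ⋃ w ∈ S, piece f K w) (hlt : ∑ w ∈ S, wordWeight c s w < 1) :
    H4 f K s = 0 := by
  set q := ∑ w ∈ S, wordWeight c s w with hq
  have hbound : ∀ n m, n ≤ m → H4n f K s n ≤ (q : ℝ≥0∞) ^ m * Metric.ediam K ^ s := by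
    intro n m hnm
    obtain ⟨T, hlen, hT, hsum⟩ := exists_iterated_cover c s hS hcov m
    refine (iInf₂_le_of_le T (fun w hw => hnm.trans (hlen w hw)) (iInf_le _ hT)).trans ?_
    calc ∑ w ∈ T, Metric.ediam (piece f K w) ^ s
        ≤ ∑ w ∈ T, (wordWeight c s w : ℝ≥0∞) * Metric.ediam K ^ s :=
          Finset.sum_le_sum fun w _ => ediam_piece_rpow_le hf K hs w
      _ = ((∑ w ∈ T, wordWeight c s w : ℝ≥0) : ℝ≥0∞) * Metric.ediam K ^ s := by
          rw [← Finset.sum_mul, ENNReal.ofNNReal_finsetSum]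
      _ ≤ (q : ℝ≥0∞) ^ m * Metric.ediam K ^ s := by
          gcongr
          exact_mod_cast hsum
  have hlim : Filter.Tendsto (fun m : ℕ => (q : ℝ≥0∞) ^ m * Metric.ediam K ^ s)
      Filter.atTop (nhds 0) := by
    have h := ENNReal.Tendsto.mul_const (b := Metric.ediam K ^ s)
      (ENNReal.tendsto_pow_atTop_nhds_zero_of_lt_one (r := (q : ℝ≥0∞)) (by exact_mod_cast hlt))
      (Or.inr (ENNReal.rpow_ne_top_of_nonneg hs hKb))
    simpa using h
  refine le_antisymm (iSup_le fun n => ?_) (zero_le)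
  exact ge_of_tendsto hlim (Filter.eventually_atTop.2 ⟨n, fun m hm => hbound n m hm⟩)

theorem continuous_wordWeight {k : ℕ} {c : Fin k → ℝ≥0} (hc : ∀ i, c i ≠ 0)
    (w : List (Fin k)) : Continuous fun s => wordWeight c s w := by
  simp only [wordWeight_eq_rpow]
  have : (w.map c).prod ≠ 0 := by simp [List.prod_eq_zero_iff, hc]
  exact continuous_iff_continuousAt.2 fun s => NNReal.continuousAt_rpow (Or.inl this) |>.comp
    (f := fun s : ℝ => ((w.map c).prod, s)) (by fun_prop)

theorem stmt_2 {X : Type*} [MetricSpace X] [CompleteSpace X]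
    {k : ℕ} (hk : 2 ≤ k) (f : Fin k → X → X) (c : Fin k → ℝ)
    (hc : ∀ i, c i ∈ Set.Ioo (0 : ℝ) 1)
    (hf : ∀ i x y, dist (f i x) (f i y) = c i * dist x y)
    (K : Set X) (hKne : K.Nonempty) (hKcp : IsCompact K)
    (hK : K = ⋃ i, f i '' K)
    (α : ℝ) (hα : 0 < α) (hαsum : ∑ i, c i ^ α = 1)
    (h4 : dim4 f K = α) (h3 : dim3 f K = α) :
    Irred f K := by
  intro w hw
  let c' : Fin k → ℝ≥0 := fun i => ⟨c i, (hc i).1.le⟩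
  have hc' : ∀ i, c' i ≠ 0 := fun i h => (hc i).1.ne' (congrArg NNReal.toReal h)
  have hf' : ∀ i, LipschitzWith (c' i) (f i) := fun i =>
    LipschitzWith.of_dist_le_mul fun x y => (hf i x y).le
  have hsum' : ∑ i, c' i ^ α = 1 := by
    apply NNReal.eq
    push_cast
    exact hαsum
  set S := (wordsOfLength k w.length).erase w with hSdef
  have hlen : 1 ≤ w.length := by
    by_contra! h
    obtain rfl := List.length_eq_zero_iff.1 (Nat.lt_one_iff.1 h)
    obtain ⟨x, hx⟩ := hKne
    have := hw ⟨x, hx, rfl⟩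
    simp at this
  have hcov : K ⊆ ⋃ v ∈ S, piece f K v := by
    intro x hx
    have hx := subset_iUnion_wordsOfLength hK w.length hx
    simp only [Set.mem_iUnion, mem_wordsOfLength, hSdef, Finset.mem_erase] at hx ⊢
    obtain ⟨v, hv, hxv⟩ := hx
    by_cases hvw : v = w
    · subst hvw
      have := hw hxv
      simp only [Set.mem_iUnion] at this
      obtain ⟨u, ⟨hu, hne⟩, hxu⟩ := this
      exact ⟨u, ⟨hne, hu⟩, hxu⟩
    · exact ⟨v, ⟨hvw, hv⟩, hxv⟩
  have hlt : ∑ v ∈ S, wordWeight c' α v < 1 := by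
    have h := Finset.sum_erase_add (wordsOfLength k w.length) (wordWeight c' α)
      (mem_wordsOfLength.2 rfl : w ∈ _)
    rw [sum_wordsOfLength, hsum', one_pow] at h
    rw [← h]
    refine lt_add_of_pos_right _ (pos_iff_ne_zero.2 ?_)
    simp [wordWeight, List.prod_eq_zero_iff, NNReal.rpow_eq_zero_iff, hc']
  have hcont : Continuous fun s => ∑ v ∈ S, wordWeight c' s v :=
    continuous_finsetSum _ fun v _ => continuous_wordWeight hc' v
  obtain ⟨s, ⟨hs, hs0⟩, hsα⟩ := (((hcont.tendsto α).eventually (gt_mem_nhds hlt)).and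
    (lt_mem_nhds hα)).filter_mono nhdsWithin_le_nhds |>.and
    (self_mem_nhdsWithin (s := Set.Iio α)) |>.exists
  have hzero : H4 f K s = 0 :=
    H4_eq_zero_of_cover hf' hKcp.isBounded.ediam_ne_top hs0.le
      (fun v hv => (mem_wordsOfLength.1 (Finset.mem_of_mem_erase hv)).symm ▸ hlen) hcov hs
  have hle : dim4 f K ≤ s := csInf_le ⟨0, fun _ h => h.1⟩ ⟨hs0.le, hzero⟩
  exact absurd (h4 ▸ hle) (not_le.2 hsα)

end IFSMoran
end

section
/- Let K be the attractor of an IFS of similitudes on a complete metric space, endowed with its natural fractal structure. If F satisfies the level separation property (LSP), then the natural fractal structure is irreducible. -/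
open scoped ENNReal

namespace IFSMoran

variable {X : Type*} [MetricSpace X]

theorem continuous_wMap {k : ℕ} {f : Fin k → X → X} (hf : ∀ i, Continuous (f i)) :
    ∀ w : List (Fin k), Continuous (wMap f w)
  | [] => continuous_id
  | i :: w => (hf i).comp (continuous_wMap hf w)

/-- A relatively open nonempty subset of `K` which misses the relative interiors of finitely many
closed sets is not covered by these sets. -/
theorem exists_mem_notMem_of_forall_intK {ι : Type*} {K : Set X} {A : ι → Set X}
    (hA : ∀ i, IsClosed (A i)) {s : Set ι} (hs : s.Finite) {U : Set X} (hU : IsOpen U)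
    (hne : (U ∩ K).Nonempty) (hint : ∀ i ∈ s, Disjoint U (intK K (A i))) :
    ∃ x ∈ U ∩ K, x ∉ ⋃ i ∈ s, A i := by
  induction s, hs using Set.Finite.induction_on generalizing U with
  | empty =>
    obtain ⟨x, hx⟩ := hne
    exact ⟨x, hx, by simp⟩
  | @insert a s _ _ ih =>
    obtain ⟨x, hxU, hxK⟩ := hne
    have hxcl : x ∈ closure (K \ A a) := by
      by_contra h
      exact Set.disjoint_left.1 (hint a (Set.mem_insert a s)) hxU ⟨hxK, h⟩
    obtain ⟨y, hyU, hyK, hyA⟩ := mem_closure_iff.1 hxcl U hU hxU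
    obtain ⟨z, ⟨⟨hzU, hzA⟩, hzK⟩, hz⟩ := ih (hU.sdiff (hA a)) ⟨y, ⟨hyU, hyA⟩, hyK⟩
      fun i hi => (hint i (Set.mem_insert_of_mem a hi)).mono_left Set.sdiff_subset
    refine ⟨z, ⟨hzU, hzK⟩, ?_⟩
    rw [Set.biUnion_insert]
    exact fun h => h.elim hzA hz

theorem intK_subset {K A : Set X} : intK K A ⊆ A := fun x hx => by
  by_contra h
  exact hx.2 (subset_closure ⟨hx.1, h⟩)

theorem stmt_7 {X : Type*} [MetricSpace X] [CompleteSpace X]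
    {k : ℕ} (hk : 2 ≤ k) (f : Fin k → X → X) (c : Fin k → ℝ)
    (hc : ∀ i, c i ∈ Set.Ioo (0 : ℝ) 1)
    (hf : ∀ i x y, dist (f i x) (f i y) = c i * dist x y)
    (K : Set X) (hKne : K.Nonempty) (hKcp : IsCompact K)
    (hK : K = ⋃ i, f i '' K)
    (hlsp : LSP f K) :
    Irred f K := by
  intro w hw
  have hcont (i : Fin k) : Continuous (f i) :=
    (LipschitzWith.of_dist_le_mul (K := ⟨c i, (hc i).1.le⟩) fun x y => (hf i x y).le).continuous
  have hclosed (v : List (Fin k)) : IsClosed (piece f K v) :=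
    (hKcp.image (continuous_wMap hcont v)).isClosed
  have hfin : {v : List (Fin k) | v.length = w.length ∧ v ≠ w}.Finite :=
    (List.finite_length_eq (Fin k) w.length).subset fun v hv => hv.1
  obtain ⟨x, hxK, hx⟩ := hlsp.2 w
  obtain ⟨y, ⟨hyU, hyK⟩, hy⟩ := exists_mem_notMem_of_forall_intK hclosed hfin
    isClosed_closure.isOpen_compl ⟨x, hx, hxK⟩ fun v hv =>
      Set.disjoint_left.2 fun z hzU hz =>
        Set.eq_empty_iff_forall_notMem.1 (hlsp.1 v w hv.1 hv.2) z ⟨hz, hz.1, hzU⟩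
  exact hy (hw (intK_subset ⟨hyK, hyU⟩))

end IFSMoran
end
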